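/- arXiv:1412.0609 — 2 statements merged into one kernel-verified Lean document; each statement's English description precedes it below -/
import Mathlib

section
/- Let f and g be continuous, positive, non-increasing functions on [0,∞) and let r ∈ ℕ. Then for every n ∈ ℤ₊, φ_{r,n,f}(∞) < ∞ if and only if φ_{r,0,f}(∞) < ∞. -/
open Set Filter MeasureTheory
open scoped Topology

noncomputable section

/-- Weighted sup-norm `‖x‖_{C(S),w} = sup_{t ∈ S} |x t| / w t`. -/
def wNorm (x w : ℝ → ℝ) (S : Set ℝ) : ℝ :=
  sSup ((fun t => |x t| / w t) '' S)

/-- Sup-norm `‖x‖_{C(S)} = sup_{t ∈ S} |x t|`. -/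
def supNorm (x : ℝ → ℝ) (S : Set ℝ) : ℝ :=
  sSup ((fun t => |x t|) '' S)

/-- `G` is a perfect `g`-spline of order `r` on `[0,a]` with exactly `m` knots
`u 1 < ⋯ < u m` (where `u 0 = 0` and `u (m+1) = a`) and sign `ε ∈ {1,-1}`:
`G ∈ C^{r-1}[0,a]`, and on each open interval between consecutive knots `G` is
`r` times differentiable with `G^{(r)}(t) = ε·(-1)^i·g(t)` there. -/
def PerfectSplineWith (g : ℝ → ℝ) (r : ℕ) (a : ℝ) (m : ℕ) (u : ℕ → ℝ) (ε : ℝ)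
    (G : ℝ → ℝ) : Prop :=
  (ε = 1 ∨ ε = -1) ∧ u 0 = 0 ∧ u (m + 1) = a ∧ (∀ i ≤ m, u i < u (i + 1)) ∧
  ContDiffOn ℝ (r - 1 : ℕ) G (Icc 0 a) ∧
  ∀ i ≤ m, ContDiffOn ℝ (r : ℕ) G (Ioo (u i) (u (i + 1))) ∧
    ∀ s ∈ Ioo (u i) (u (i + 1)),
      iteratedDerivWithin r G (Ioo (u i) (u (i + 1))) s = ε * (-1 : ℝ) ^ i * g s

/-- `Γ^r_{n,g}[0,a]`: perfect `g`-splines of order `r` on `[0,a]` with at most `n` knots. -/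
def InGamma (g : ℝ → ℝ) (r n : ℕ) (a : ℝ) (G : ℝ → ℝ) : Prop :=
  ∃ m ≤ n, ∃ u : ℕ → ℝ, ∃ ε : ℝ, PerfectSplineWith g r a m u ε G

/-- `b 1 < ⋯ < b (n+r+1)` are `n+r+1` oscillation points of `G` on `[0,a]`
with respect to the weight `f`, as in (5). -/
def OscPointsAt (f : ℝ → ℝ) (r n : ℕ) (a : ℝ) (G : ℝ → ℝ) (b : ℕ → ℝ) : Prop :=
  0 ≤ b 1 ∧ b (n + r + 1) = a ∧ (∀ i, 1 ≤ i → i < n + r + 1 → b i < b (i + 1)) ∧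
  ∀ i, 1 ≤ i → i ≤ n + r + 1 →
    G (b i) = (-1 : ℝ) ^ (i + r + 1) * (wNorm G f (Icc 0 a) * f (b i))

/-- `G` has `n+r+1` oscillation points on `[0,a]`. -/
def HasOsc (f : ℝ → ℝ) (r n : ℕ) (a : ℝ) (G : ℝ → ℝ) : Prop :=
  ∃ b : ℕ → ℝ, OscPointsAt f r n a G b

/-- `G` is the extremal spline `G_{r,n,f,a}`: a member of `Γ^r_{n,g}[0,a]`
with `n+r+1` oscillation points. -/
def IsExtremalSpline (f g : ℝ → ℝ) (r n : ℕ) (a : ℝ) (G : ℝ → ℝ) : Prop :=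
  InGamma g r n a G ∧ HasOsc f r n a G

/-- Iterated antiderivatives: `g_0 = g`, `g_{k+1}(t) = ∫_0^t g_k`. -/
def gk (g : ℝ → ℝ) : ℕ → ℝ → ℝ
  | 0 => g
  | k + 1 => fun t => ∫ s in (0:ℝ)..t, gk g k s

/-- The constants `A_k` of the paper:
`A_0 = ∫_0^∞ g`, and
`A_k = ∫_0^∞ [ Σ_{s=0}^{k-1} (-1)^{k-s-1} A_s t^{k-s-1}/(k-s-1)! + (-1)^k g_k(t) ] dt`. -/
def Acoef (g : ℝ → ℝ) : ℕ → ℝ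
  | 0 => ∫ t in Ioi (0 : ℝ), g t
  | k + 1 => ∫ t in Ioi (0 : ℝ),
      ((∑ s : Fin (k + 1), (-1 : ℝ) ^ (k - s.1) * Acoef g s.1 * t ^ (k - s.1) /
        (Nat.factorial (k - s.1) : ℝ)) + (-1 : ℝ) ^ (k + 1) * gk g (k + 1) t)

/-- `P_k(t) = Σ_{s=0}^{k-1} (-1)^{k-s-1} A_s t^{k-s-1}/(k-s-1)! + (-1)^k g_k(t)`. -/
def Pfun (g : ℝ → ℝ) (k : ℕ) (t : ℝ) : ℝ :=
  (∑ s : Fin k, (-1 : ℝ) ^ (k - 1 - s.1) * Acoef g s.1 * t ^ (k - 1 - s.1) /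
    (Nat.factorial (k - 1 - s.1) : ℝ)) + (-1 : ℝ) ^ k * gk g k t

/-- Conditions (6): `A_0 < ∞` and `A_k < ∞` for `k = 1, …, r-1`,
expressed as integrability of the corresponding integrands over `(0,∞)`. -/
def Cond6 (g : ℝ → ℝ) (r : ℕ) : Prop :=
  IntegrableOn g (Ioi 0) ∧ ∀ k, 1 ≤ k → k ≤ r - 1 → IntegrableOn (Pfun g k) (Ioi 0)

/-- Membership in the class `W^r_{f,g}(ℝ₊)`: `x ∈ C[0,∞)` with
`‖x‖_{C[0,∞),f} < ∞`, `x ∈ C^{r-1}[0,∞)`, `x^{(r-1)}` locally absolutely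
continuous with `|x^{(r)}| ≤ g` a.e., the latter encoded by the increment bound
`|x^{(r-1)}(t) - x^{(r-1)}(s)| ≤ ∫_s^t g`. -/
def MemW (f g : ℝ → ℝ) (r : ℕ) (x : ℝ → ℝ) : Prop :=
  ContinuousOn x (Ici 0) ∧
  ContDiffOn ℝ (r - 1 : ℕ) x (Ici 0) ∧
  BddAbove ((fun t => |x t| / f t) '' Ici 0) ∧
  ∀ s t : ℝ, 0 ≤ s → s ≤ t →
    |iteratedDerivWithin (r - 1) x (Ici 0) t - iteratedDerivWithin (r - 1) x (Ici 0) s| ≤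
      ∫ u in s..t, g u

/-- The modulus of continuity `ω(D^k, δ)` of the `k`-th differentiation operator on
`W^r_{f,g}(ℝ₊)`. -/
def omegaD (f g : ℝ → ℝ) (r k : ℕ) (δ : ℝ) : ℝ :=
  sSup {y | ∃ x : ℝ → ℝ, MemW f g r x ∧ wNorm x f (Ici 0) ≤ δ ∧
    y = supNorm (iteratedDerivWithin k x (Ici 0)) (Ici 0)}

/-- A perfect `g`-spline of order `r` on `[0,∞)` with exactly `n` knots
`u 1 < ⋯ < u n` (and `u 0 = 0`), sign `ε`. -/
def PerfectSplineInf (g : ℝ → ℝ) (r n : ℕ) (u : ℕ → ℝ) (ε : ℝ) (Q : ℝ → ℝ) : Prop :=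
  (ε = 1 ∨ ε = -1) ∧ u 0 = 0 ∧ (∀ i < n, u i < u (i + 1)) ∧
  ContDiffOn ℝ (r - 1 : ℕ) Q (Ici 0) ∧
  (∀ i < n, ContDiffOn ℝ (r : ℕ) Q (Ioo (u i) (u (i + 1))) ∧
    ∀ s ∈ Ioo (u i) (u (i + 1)),
      iteratedDerivWithin r Q (Ioo (u i) (u (i + 1))) s = ε * (-1 : ℝ) ^ i * g s) ∧
  ContDiffOn ℝ (r : ℕ) Q (Ioi (u n)) ∧
  ∀ s ∈ Ioi (u n), iteratedDerivWithin r Q (Ioi (u n)) s = ε * (-1 : ℝ) ^ n * g s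

end

def pf (r : ℕ) (c : ℕ → ℝ) (x : ℝ) : ℝ := ∑ i ∈ Finset.range r, c i * x ^ i

lemma pf_hasDeriv (r : ℕ) (c : ℕ → ℝ) (x : ℝ) :
    HasDerivAt (pf (r+1) c) (pf r (fun i => c (i+1) * (i+1)) x) x := by
  have h : pf (r+1) c = fun x => (∑ i ∈ Finset.range r, c (i+1) * x ^ (i+1)) + c 0 := by
    funext x; simp [pf, Finset.sum_range_succ']
  rw [h]
  apply HasDerivAt.add_const
  unfold pf
  apply HasDerivAt.fun_sum
  intro i _
  have := (hasDerivAt_pow (i+1) x).const_mul (c (i+1))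
  have e : c (i+1) * ((i:ℝ)+1) * x^i = c (i+1) * (((i+1:ℕ):ℝ) * x^(i+1-1)) := by
    push_cast
    ring
  rw [e]
  exact this

lemma gk_cont (g : ℝ → ℝ) (hg : Continuous g) : ∀ k, Continuous (gk g k)
  | 0 => hg
  | k + 1 => by
    have := gk_cont g hg k
    exact intervalIntegral.continuous_primitive (fun a b => this.intervalIntegrable a b) 0

lemma gk_hasDeriv (g : ℝ → ℝ) (hg : Continuous g) (k : ℕ) (x : ℝ) :
    HasDerivAt (gk g (k+1)) (gk g k x) x := by
  have h := gk_cont g hg k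
  exact intervalIntegral.integral_hasDerivAt_right (h.intervalIntegrable _ _)
    (h.stronglyMeasurableAtFilter _ _) h.continuousAt

lemma P_smooth (g : ℝ → ℝ) (hg : Continuous g) (r : ℕ) : ∀ c : ℕ → ℝ,
    ContDiff ℝ (r:ℕ) (fun x => gk g r x + pf r c x) ∧
      iteratedDeriv r (fun x => gk g r x + pf r c x) = g := by
  induction r with
  | zero =>
    intro c
    simp [pf, gk, hg]
  | succ r ih =>
    intro c
    have hd : ∀ x, HasDerivAt (fun x => gk g (r+1) x + pf (r+1) c x)
      (gk g r x + pf r (fun i => c (i+1) * (i+1)) x) x := fun x =>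
      (gk_hasDeriv g hg r x).add (pf_hasDeriv r c x)
    have hd' : deriv (fun x => gk g (r+1) x + pf (r+1) c x) =
      fun x => gk g r x + pf r (fun i => c (i+1) * (i+1)) x := funext fun x => (hd x).deriv
    obtain ⟨h1, h2⟩ := ih (fun i => c (i+1) * (i+1))
    constructor
    · push_cast
      rw [contDiff_succ_iff_deriv]
      refine ⟨fun x => (hd x).differentiableAt, by simp, ?_⟩
      rw [hd']; exact h1
    · rw [iteratedDeriv_succ', hd', h2]

lemma rep (g : ℝ → ℝ) (hg : Continuous g) (s t : ℝ) (σ : ℝ) (r : ℕ) :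
    ∀ G : ℝ → ℝ, ContDiffOn ℝ (r:ℕ) G (Ioo s t) →
    (∀ x ∈ Ioo s t, iteratedDerivWithin r G (Ioo s t) x = σ * g x) →
    ∃ c, ∀ x ∈ Ioo s t, G x = σ * gk g r x + pf r c x := by
  induction r with
  | zero =>
    intro G _ h
    refine ⟨0, fun x hx => ?_⟩
    simpa [pf, gk] using h x hx
  | succ r ih =>
    intro G hG h
    have hu : UniqueDiffOn ℝ (Ioo s t) := isOpen_Ioo.uniqueDiffOn
    push_cast at hG
    have hG' := (contDiffOn_succ_iff_derivWithin hu).1 hG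
    obtain ⟨c, hc⟩ := ih (derivWithin G (Ioo s t)) hG'.2.2 (by
      intro x hx
      rw [← iteratedDerivWithin_succ']
      exact h x hx)
    let d : ℕ → ℝ := fun i => c (i-1) / i
    have hd : ∀ x, HasDerivAt (fun x => σ * gk g (r+1) x + pf (r+1) d x)
        (σ * gk g r x + pf r c x) x := by
      intro x
      have := ((gk_hasDeriv g hg r x).const_mul σ).add (pf_hasDeriv r d x)
      have e : (fun i : ℕ => d (i+1) * ((i:ℝ)+1)) = c := by
        funext i
        simp only [d]
        push_cast
        have : (i:ℝ) + 1 ≠ 0 := by positivity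
        field_simp
        try simp
      rw [e] at this
      exact this
    have hdG : ∀ x ∈ Ioo s t, HasDerivAt G (σ * gk g r x + pf r c x) x := by
      intro x hx
      rw [← hc x hx]
      exact ((hG'.1 x hx).hasDerivWithinAt).hasDerivAt (isOpen_Ioo.mem_nhds hx)
    obtain ⟨e, he⟩ := isOpen_Ioo.exists_is_const_of_deriv_eq_zero (s := Ioo s t)
      (f := fun x => G x - (σ * gk g (r+1) x + pf (r+1) d x)) isPreconnected_Ioo
      (fun x hx => ((hdG x hx).sub (hd x)).differentiableAt.differentiableWithinAt)
      (fun x hx => by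
        have := ((hdG x hx).sub (hd x)).deriv
        rw [sub_self] at this
        exact this)
    refine ⟨fun i => if i = 0 then d 0 + e else d i, fun x hx => ?_⟩
    have := he x hx
    have h2 : pf (r+1) (fun i => if i = 0 then d 0 + e else d i) x = pf (r+1) d x + e := by
      simp [pf, Finset.sum_range_succ']; ring
    rw [h2]; linarith

lemma pf_bound (r : ℕ) (T : ℝ) (_hT : 0 ≤ T) : ∃ L, 0 ≤ L ∧ ∀ (c : ℕ → ℝ) (B : ℝ),
    (∀ x ∈ Ioo T (T+1), |pf r c x| ≤ B) → ∀ x ∈ Icc 0 (T+1), |pf r c x| ≤ L * B := by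
  let v : ℕ → ℝ := fun i => T + ((i:ℝ)+1)/(r+1)
  have hr : (0:ℝ) < r + 1 := by positivity
  have hv : Set.InjOn v (Finset.range r : Finset ℕ) := by
    intro i _ j _ hij
    simp only [v] at hij
    have := add_left_cancel hij
    rw [div_left_inj' hr.ne'] at this
    exact_mod_cast add_right_cancel this
  have hb : ∀ i, ∃ K, ∀ x ∈ Icc 0 (T+1), |(Lagrange.basis (Finset.range r) v i).eval x| ≤ K := by
    intro i
    obtain ⟨K, hK⟩ := isCompact_Icc.exists_bound_of_continuousOn (s := Icc 0 (T+1))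
      (f := fun x => (Lagrange.basis (Finset.range r) v i).eval x) (Polynomial.continuous _).continuousOn
    exact ⟨K, hK⟩
  choose K hK using hb
  refine ⟨∑ i ∈ Finset.range r, |K i|, Finset.sum_nonneg fun _ _ => abs_nonneg _, ?_⟩
  intro c B hB x hx
  let p : Polynomial ℝ := ∑ i : Fin r, Polynomial.C (c i) * Polynomial.X ^ (i:ℕ)
  have hp : ∀ y, p.eval y = pf r c y := by
    intro y
    simp [p, pf, Polynomial.eval_finsetSum, Finset.sum_range]
  have hdeg : p.degree < (Finset.range r).card := by
    rw [Finset.card_range]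
    exact Polynomial.degree_sum_fin_lt _
  have e := Lagrange.eq_interpolate hv hdeg
  rw [← hp x, e, Lagrange.interpolate_apply, Polynomial.eval_finsetSum, Finset.sum_mul]
  refine (Finset.abs_sum_le_sum_abs _ _).trans (Finset.sum_le_sum fun i hi => ?_)
  rw [Polynomial.eval_mul, Polynomial.eval_C, abs_mul, hp, mul_comm]
  have hi' : (i:ℝ) + 1 < r + 1 := by
    have := Finset.mem_range.1 hi
    exact_mod_cast Nat.succ_lt_succ this
  refine mul_le_mul ?_ ?_ (abs_nonneg _) (abs_nonneg _)
  · exact (hK i x hx).trans (le_abs_self _)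
  · apply hB
    constructor
    · simp only [v]; have : 0 < ((i:ℝ)+1)/(r+1) := by positivity
      linarith
    · simp only [v]; have : ((i:ℝ)+1)/(r+1) < 1 := by rw [div_lt_one hr]; exact hi'
      linarith

lemma alt_step (D D' : ℝ → ℝ) (a : ℝ) (hc : ContinuousOn D (Icc 0 a))
    (hd : ∀ x ∈ Ioo 0 a, HasDerivAt D (D' x) x) (N : ℕ) (s : ℝ)
    (h : ∃ c : ℕ → ℝ, (∀ i ≤ N, c i < c (i+1)) ∧ (∀ i ≤ N + 1, c i ∈ Icc 0 a) ∧
      ∀ i ≤ N + 1, 0 < (-1:ℝ)^i * s * D (c i)) :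
    ∃ c : ℕ → ℝ, (∀ i < N, c i < c (i+1)) ∧ (∀ i ≤ N, c i ∈ Icc 0 a) ∧
      ∀ i ≤ N, 0 < (-1:ℝ)^i * (-s) * D' (c i) := by
  obtain ⟨c, h1, h2, h3⟩ := h
  have key : ∀ i, ∃ x, i ≤ N → x ∈ Ioo (c i) (c (i+1)) ∧ D' x = (D (c (i+1)) - D (c i)) / (c (i+1) - c i) := by
    intro i
    by_cases hi : i ≤ N
    · have ha := h2 i (by omega)
      have hb := h2 (i+1) (by omega)
      obtain ⟨x, hx, hx'⟩ := exists_hasDerivAt_eq_slope D D' (h1 i hi)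
        (hc.mono (Icc_subset_Icc ha.1 hb.2)) (fun x hx => hd x ⟨ha.1.trans_lt hx.1, hx.2.trans_le hb.2⟩)
      exact ⟨x, fun _ => ⟨hx, hx'⟩⟩
    · exact ⟨0, fun h => absurd h hi⟩
  choose x hx using key
  refine ⟨x, fun i hi => ?_, fun i hi => ?_, fun i hi => ?_⟩
  · exact ((hx i hi.le).1.2).trans ((hx (i+1) hi).1.1)
  · have ha := h2 i (by omega)
    have hb := h2 (i+1) (by omega)
    have := (hx i hi).1
    exact ⟨ha.1.trans this.1.le, this.2.le.trans hb.2⟩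
  · rw [(hx i hi).2]
    have e1 := h3 i (by omega)
    have e2 := h3 (i+1) (by omega)
    have e3 := sub_pos.2 (h1 i hi)
    rw [mul_div_assoc']
    apply div_pos _ e3
    rw [pow_succ] at e2
    linarith

lemma alt_iter (D : ℕ → ℝ → ℝ) (a : ℝ) (k : ℕ) (hc : ∀ j < k, ContinuousOn (D j) (Icc 0 a))
    (hd : ∀ j < k, ∀ x ∈ Ioo 0 a, HasDerivAt (D j) (D (j+1) x) x) (N : ℕ) :
    ∀ j ≤ k, ∀ s : ℝ, (∃ c : ℕ → ℝ, (∀ i < N + j, c i < c (i+1)) ∧ (∀ i ≤ N + j, c i ∈ Icc 0 a) ∧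
      ∀ i ≤ N + j, 0 < (-1:ℝ)^i * s * D (k - j) (c i)) →
    ∃ s : ℝ, ∃ c : ℕ → ℝ, (∀ i < N, c i < c (i+1)) ∧ (∀ i ≤ N, c i ∈ Icc 0 a) ∧
      ∀ i ≤ N, 0 < (-1:ℝ)^i * s * D k (c i) := by
  intro j
  induction j with
  | zero => intro _ s h; exact ⟨s, by simpa using h⟩
  | succ j ih =>
    intro hj s h
    have hk : k - (j+1) + 1 = k - j := by omega
    obtain ⟨c, h1, h2, h3⟩ := h
    refine ih (by omega) (-s) ?_
    rw [← hk]
    exact alt_step (D (k-(j+1))) (D (k-(j+1)+1)) a (hc _ (by omega)) (hd _ (by omega)) (N+j) s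
      ⟨c, fun i hi => h1 i (by omega), fun i hi => h2 i (by omega), fun i hi => h3 i (by omega)⟩

lemma u_mono (m : ℕ) (u : ℕ → ℝ) (hu : ∀ i ≤ m, u i < u (i+1)) :
    ∀ j ≤ m + 1, ∀ i ≤ j, u i ≤ u j := by
  intro j
  induction j with
  | zero => intro _ i hi; simp_all
  | succ j ih =>
    intro hj i hi
    rcases Nat.lt_or_ge i (j+1) with h | h
    · exact (ih (by omega) i (by omega)).trans (hu j (by omega)).le
    · have : i = j+1 := by omega
      rw [this]

lemma wn_le (f G : ℝ → ℝ) (a : ℝ) (hf_c : ContinuousOn f (Ici 0)) (hf_pos : ∀ t ∈ Ici (0:ℝ), 0 < f t)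
    (hG : ContinuousOn G (Icc 0 a)) : ∀ t ∈ Icc 0 a, |G t| ≤ wNorm G f (Icc 0 a) * f t := by
  intro t ht
  have hc : ContinuousOn (fun t => |G t| / f t) (Icc 0 a) :=
    hG.abs.div (hf_c.mono Icc_subset_Ici_self) (fun x hx => (hf_pos x hx.1).ne')
  have hb := (isCompact_Icc.image_of_continuousOn hc).bddAbove
  have := le_csSup hb (mem_image_of_mem _ ht)
  exact (div_le_iff₀ (hf_pos t ht.1)).1 this

lemma top_deriv (g G : ℝ → ℝ) (k : ℕ) (a p q w : ℝ) (hp : 0 ≤ p) (hq : q ≤ a) 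
    (hG : ContDiffOn ℝ (k+1 : ℕ) G (Ioo p q))
    (hd : ∀ s ∈ Ioo p q, iteratedDerivWithin (k+1) G (Ioo p q) s = w * g s) :
    ∀ s ∈ Ioo p q, HasDerivAt (iteratedDerivWithin k G (Icc 0 a)) (w * g s) s := by
  intro s hs
  have hu : UniqueDiffOn ℝ (Ioo p q) := isOpen_Ioo.uniqueDiffOn
  have h1 := hG.differentiableOn_iteratedDerivWithin (m := k) (by exact_mod_cast Nat.lt_succ_self k) hu
  have h2 := ((h1 s hs).hasDerivWithinAt).hasDerivAt (isOpen_Ioo.mem_nhds hs)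
  rw [← iteratedDerivWithin_succ, hd s hs] at h2
  refine h2.congr_of_eventuallyEq ?_
  filter_upwards [isOpen_Ioo.mem_nhds hs] with y hy
  have e : (Icc 0 a : Set ℝ) =ᶠ[𝓝 y] Ioo p q := by
    filter_upwards [isOpen_Ioo.mem_nhds hy] with z hz
    have : z ∈ Icc 0 a := ⟨hp.trans hz.1.le, hz.2.le.trans hq⟩
    exact propext ⟨fun _ => hz, fun _ => this⟩
  rw [iteratedDerivWithin, iteratedDerivWithin, iteratedFDerivWithin_congr_set e]

lemma comp (f g : ℝ → ℝ) (hf_pos : ∀ t ∈ Ici (0:ℝ), 0 < f t)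
    (hg_pos : ∀ t ∈ Ici (0:ℝ), 0 < g t)
    (k n : ℕ) (a : ℝ) (ha : 0 < a) (G : ℝ → ℝ) (hG : IsExtremalSpline f g (k+1) n a G)
    (P : ℝ → ℝ) (hP : ContDiff ℝ (k+1:ℕ) P) (hPd : ∀ x ∈ Ioo 0 a, iteratedDeriv (k+1) P x = g x)
    (M : ℝ) (hM : ∀ x ∈ Icc 0 a, |P x| ≤ M * f x) : wNorm G f (Icc 0 a) ≤ M := by
  by_contra hlt
  push Not at hlt
  obtain ⟨⟨m, hmn, u, ε, hε, hu0, hua, hu, hGc, hGi⟩, b, hb1, hb2, hb3, hb4⟩ := hG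
  simp only [Nat.add_sub_cancel] at hGc
  have hε2 : ε * ε = 1 := by rcases hε with h | h <;> rw [h] <;> norm_num
  have hεa : |ε| = 1 := by rcases hε with h | h <;> rw [h] <;> norm_num
  have hmono := u_mono m u hu
  have hUD : UniqueDiffOn ℝ (Icc 0 a) := uniqueDiffOn_Icc ha
  set D : ℕ → ℝ → ℝ := fun j x => iteratedDerivWithin j G (Icc 0 a) x - ε * iteratedDeriv j P x with hD
  have hDc : ∀ j ≤ k, ContinuousOn (D j) (Icc 0 a) := by
    intro j hj
    refine (hGc.continuousOn_iteratedDerivWithin (by exact_mod_cast hj) hUD).sub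
      (continuousOn_const.mul (hP.continuous_iteratedDeriv j (by exact_mod_cast (by omega))).continuousOn)
  have hPder : ∀ j ≤ k, ∀ x, HasDerivAt (iteratedDeriv j P) (iteratedDeriv (j+1) P x) x := by
    intro j hj x
    rw [iteratedDeriv_succ]
    exact (hP.differentiable_iteratedDeriv j (by exact_mod_cast (by omega)) x).hasDerivAt
  have hDd : ∀ j < k, ∀ x ∈ Ioo 0 a, HasDerivAt (D j) (D (j+1) x) x := by
    intro j hj x hx
    refine HasDerivAt.sub ?_ ((hPder j hj.le x).const_mul ε)
    rw [iteratedDerivWithin_succ]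
    exact ((hGc.differentiableOn_iteratedDerivWithin (by exact_mod_cast hj) hUD x
      (Ioo_subset_Icc_self hx)).hasDerivWithinAt).hasDerivAt (Icc_mem_nhds hx.1 hx.2)
  have hDk : ∀ i ≤ m, ∀ x ∈ Ioo (u i) (u (i+1)),
      HasDerivAt (fun x => ε * D k x) (((-1)^i - 1) * g x) x := by
    intro i hi x hx
    have h0 : 0 ≤ u i := by rw [← hu0]; exact hmono i (by omega) 0 (by omega)
    have h1 : u (i+1) ≤ a := by rw [← hua]; exact hmono (m+1) (by omega) (i+1) (by omega)
    have e1 := top_deriv g G k a (u i) (u (i+1)) _ h0 h1 (hGi i hi).1 (hGi i hi).2 x hx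
    have e2 := (hPder k le_rfl x).const_mul ε
    rw [hPd x ⟨h0.trans_lt hx.1, hx.2.trans_le h1⟩] at e2
    have e3 := (e1.sub e2).const_mul ε
    have : ε * (ε * (-1) ^ i * g x - ε * g x) = ((-1)^i - 1) * g x := by
      linear_combination ((-1)^i - 1) * g x * hε2
    rw [this] at e3
    exact e3
  -- alternation
  have hbmono := u_mono (n + k) (fun i => b (i+1)) (fun i hi => hb3 (i+1) (by omega) (by omega))
  have halt := alt_iter D a k (fun j hj => hDc j hj.le) hDd (n+1) k le_rfl (-(-1)^k)
    ⟨fun i => b (i+1), fun i hi => hb3 (i+1) (by omega) (by omega), fun i hi => by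
      constructor
      · exact hb1.trans (hbmono i (by omega) 0 (by omega))
      · rw [← hb2]; exact hbmono (n+k+1) (by omega) i (by omega), fun i hi => by
      have hmem : b (i+1) ∈ Icc 0 a := by
        constructor
        · exact hb1.trans (hbmono i (by omega) 0 (by omega))
        · rw [← hb2]; exact hbmono (n+k+1) (by omega) i (by omega)
      have hf := hf_pos _ hmem.1
      have e1 := hb4 (i+1) (by omega) (by omega)
      have e2 : |ε * P (b (i+1))| ≤ M * f (b (i+1)) := by
        rw [abs_mul, hεa, one_mul]; exact hM _ hmem
      have e3 : M * f (b (i+1)) < wNorm G f (Icc 0 a) * f (b (i+1)) := by gcongr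
      have e4 : (-1:ℝ)^(i + 1 + (k+1) + 1) = (-1)^i * (-1)^k * (-1) := by ring
      rw [e4] at e1
      have e5 : D (k - k) (b (i+1)) = G (b (i+1)) - ε * P (b (i+1)) := by
        simp [hD]
      rw [e5, e1]
      have e6 := abs_le.1 e2
      rcases neg_one_pow_eq_or ℝ i with h | h <;> rcases neg_one_pow_eq_or ℝ k with h' | h' <;>
        rw [h, h'] <;> linarith⟩
  obtain ⟨s, c, hc1, hc2, hc3⟩ := halt
  have hcont : ContinuousOn (fun x => ε * D k x) (Icc 0 a) := continuousOn_const.mul (hDc k le_rfl)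
  have hanti : ∀ i ≤ m + 1, AntitoneOn (fun x => ε * D k x) (Icc 0 (u i)) := by
    intro i
    induction i with
    | zero =>
      intro _
      rw [hu0, Icc_self]
      exact Set.subsingleton_singleton.antitoneOn _
    | succ i ih =>
      intro hi
      have h0 : 0 ≤ u i := by rw [← hu0]; exact hmono i (by omega) 0 (by omega)
      have h1 : u (i+1) ≤ a := by rw [← hua]; exact hmono (m+1) (by omega) (i+1) (by omega)
      have h2 := hu i (by omega)
      have h3 : AntitoneOn (fun x => ε * D k x) (Icc (u i) (u (i+1))) := by
        apply antitoneOn_of_deriv_nonpos (convex_Icc _ _) (hcont.mono (Icc_subset_Icc h0 h1))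
        · rw [interior_Icc]
          exact fun x hx => (hDk i (by omega) x hx).differentiableAt.differentiableWithinAt
        · rw [interior_Icc]
          intro x hx
          rw [(hDk i (by omega) x hx).deriv]
          have := hg_pos x (h0.trans hx.1.le)
          rcases neg_one_pow_eq_or ℝ i with h | h <;> rw [h] <;> linarith
      rw [← Icc_union_Icc_eq_Icc h0 h2.le]
      exact (ih (by omega)).union_right h3 (isGreatest_Icc h0) (isLeast_Icc h2.le)
  have hA := hanti (m+1) le_rfl
  rw [hua] at hA
  have q0 := hc3 0 (by omega)
  have q1 := hc3 1 (by omega)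
  have l01 := hA (hc2 0 (by omega)) (hc2 1 (by omega)) (hc1 0 (by omega)).le
  simp only [pow_zero, pow_one, one_mul] at q0 q1 l01
  have hs : s ≠ 0 := by rintro rfl; simp at q0
  have hs2 : 0 < s * s := mul_self_pos.2 hs
  have p01 : D k (c 0) * D k (c 1) < 0 := by nlinarith [mul_pos q0 q1]
  rcases Nat.eq_zero_or_pos n with hn | hn
  · have hm : m = 0 := by omega
    subst hm
    have hB : MonotoneOn (fun x => ε * D k x) (Icc 0 a) := by
      have hDk0 := hDk 0 le_rfl
      rw [hu0, zero_add, show u 1 = a from hua] at hDk0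
      apply monotoneOn_of_deriv_nonneg (convex_Icc _ _) hcont
      · rw [interior_Icc]
        exact fun x hx => (hDk0 x hx).differentiableAt.differentiableWithinAt
      · rw [interior_Icc]
        intro x hx
        rw [(hDk0 x hx).deriv]
        simp
    have l10 := hB (hc2 0 (by omega)) (hc2 1 (by omega)) (hc1 0 (by omega)).le
    simp only at l10
    have : ε * D k (c 0) = ε * D k (c 1) := le_antisymm l10 l01
    have hε0 : ε ≠ 0 := by rintro rfl; simp at hε2
    rw [mul_left_cancel₀ hε0 this] at p01
    nlinarith [mul_self_nonneg (D k (c 1))]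
  · have q2 := hc3 2 (by omega)
    have l12 := hA (hc2 1 (by omega)) (hc2 2 (by omega)) (hc1 1 (by omega)).le
    simp only at l12
    have p12 : D k (c 1) * D k (c 2) < 0 := by nlinarith [mul_pos q1 q2]
    rcases hε with h | h <;> rw [h] at l01 l12 <;>
      rcases lt_or_ge (D k (c 1)) 0 with h' | h' <;> nlinarith

def Good (f gc : ℝ → ℝ) (r : ℕ) (C a T : ℝ) (k : ℕ) : Prop :=
  ∃ (G : ℝ → ℝ) (S : Finset ℝ), (∀ t ∈ Ioo 0 a, |G t| ≤ C * f t) ∧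
    (∀ s t, 0 ≤ s → s < t → t ≤ a → (∀ x ∈ S, x ∉ Ioo s t) →
      ∃ σ : ℝ, (σ = 1 ∨ σ = -1) ∧ ∃ c, ∀ x ∈ Ioo s t, G x = σ * gk gc r x + pf r c x) ∧
    (S.filter (fun x => T < x ∧ x < a)).card ≤ k

lemma good_zero (f gc : ℝ → ℝ) (r : ℕ) (C : ℝ) (k : ℕ)
    (h : ∃ T, 0 ≤ T ∧ ∀ a, T < a → Good f gc r C a T k) :
    ∃ T, 0 ≤ T ∧ ∀ a, T < a → Good f gc r C a T 0 := by
  induction k with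
  | zero => exact h
  | succ k ih =>
    by_cases hk : ∃ T, 0 ≤ T ∧ ∀ a, T < a → Good f gc r C a T k
    · exact ih hk
    · push Not at hk
      obtain ⟨T, hT, h⟩ := h
      obtain ⟨a1, ha1, hb⟩ := hk T hT
      refine ⟨a1, hT.trans ha1.le, fun a ha => ?_⟩
      obtain ⟨G, S, h1, h2, h3⟩ := h a (ha1.trans ha)
      refine ⟨G, S, h1, h2, ?_⟩
      by_contra hne
      apply hb
      refine ⟨G, S, fun t ht => h1 t ⟨ht.1, ht.2.trans ha⟩,
        fun s t h0 hst hta => h2 s t h0 hst (hta.trans ha.le), ?_⟩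
      have hd : Disjoint (S.filter (fun x => T < x ∧ x < a1)) (S.filter (fun x => a1 < x ∧ x < a)) := by
        rw [Finset.disjoint_filter]
        intro x _ h h'
        linarith [h.2, h'.1]
      have hsub : (S.filter (fun x => T < x ∧ x < a1)) ∪ (S.filter (fun x => a1 < x ∧ x < a)) ⊆
          S.filter (fun x => T < x ∧ x < a) := by
        intro x hx
        simp only [Finset.mem_union, Finset.mem_filter] at hx ⊢
        rcases hx with ⟨h, h', h''⟩ | ⟨h, h', h''⟩
        · exact ⟨h, h', h''.trans ha⟩
        · exact ⟨h, ha1.trans h', h''⟩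
      have := Finset.card_le_card hsub
      rw [Finset.card_union_of_disjoint hd] at this
      omega

lemma spline_rep (g gc : ℝ → ℝ) (hgc : Continuous gc) (hgg : ∀ x, 0 ≤ x → gc x = g x) (r m : ℕ) (a : ℝ)
    (u : ℕ → ℝ) (ε : ℝ) (G : ℝ → ℝ) (h : PerfectSplineWith g r a m u ε G) (i : ℕ) (hi : i ≤ m) :
    ∃ σ : ℝ, (σ = 1 ∨ σ = -1) ∧ ∃ c, ∀ x ∈ Ioo (u i) (u (i+1)), G x = σ * gk gc r x + pf r c x := by
  obtain ⟨hε, hu0, hua, hu, hGc, hGi⟩ := h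
  have h0 : 0 ≤ u i := by rw [← hu0]; exact u_mono m u hu i (by omega) 0 (by omega)
  refine ⟨ε * (-1)^i, ?_, rep gc hgc _ _ _ r G (hGi i hi).1 ?_⟩
  · rcases neg_one_pow_eq_or ℝ i with h | h <;> rw [h] <;> rcases hε with h | h <;> rw [h] <;> norm_num
  · intro x hx
    rw [(hGi i hi).2 x hx, hgg x (h0.trans hx.1.le)]

lemma spline_good (f g gc : ℝ → ℝ) (hgc : Continuous gc) (hgg : ∀ x, 0 ≤ x → gc x = g x)
    (r n : ℕ) (C a : ℝ) (G : ℝ → ℝ) (h : InGamma g r n a G) 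
    (hC : ∀ t ∈ Icc 0 a, |G t| ≤ C * f t) : Good f gc r C a 0 n := by
  obtain ⟨m, hm, u, ε, h⟩ := h
  refine ⟨G, (Finset.Icc 1 m).image u, fun t ht => hC t (Ioo_subset_Icc_self ht), ?_, ?_⟩
  · intro s t hs hst hta hS
    have h' := h
    obtain ⟨hε, hu0, hua, hu, hGc, hGi⟩ := h'
    let i := Nat.findGreatest (fun i => u i ≤ s) m
    have hi : i ≤ m := Nat.findGreatest_le m
    have hi1 : u i ≤ s := Nat.findGreatest_spec (P := fun i => u i ≤ s) (Nat.zero_le m) (by rw [hu0]; exact hs)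
    have hi2 : t ≤ u (i+1) := by
      rcases Nat.lt_or_ge i m with hlt | hge
      · have h1 : ¬ u (i+1) ≤ s :=
          Nat.findGreatest_is_greatest (P := fun i => u i ≤ s) (Nat.lt_succ_self i) hlt
        have h2 := hS (u (i+1)) (Finset.mem_image_of_mem _ (Finset.mem_Icc.2 ⟨by omega, hlt⟩))
        by_contra h3
        exact h2 ⟨not_le.1 h1, not_le.1 h3⟩
      · have : i = m := by omega
        rw [this, hua]; exact hta
    obtain ⟨σ, hσ, c, hc⟩ := spline_rep g gc hgc hgg r m a u ε G h i hi
    exact ⟨σ, hσ, c, fun x hx => hc x ⟨hi1.trans_lt hx.1, hx.2.trans_le hi2⟩⟩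
  · refine (Finset.card_filter_le _ _).trans (Finset.card_image_le.trans ?_)
    simpa using hm

lemma normz (f gc G : ℝ → ℝ) (r : ℕ) (C p q σ : ℝ) (hσ : σ = 1 ∨ σ = -1) (c : ℕ → ℝ)
    (hc : ∀ x ∈ Ioo p q, G x = σ * gk gc r x + pf r c x) (hC : ∀ x ∈ Ioo p q, |G x| ≤ C * f x) :
    ∃ c', ∀ x ∈ Ioo p q, |gk gc r x + pf r c' x| ≤ C * f x := by
  refine ⟨fun i => σ * c i, fun x hx => ?_⟩
  have e : gk gc r x + pf r (fun i => σ * c i) x = σ * G x := by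
    have : pf r (fun i => σ * c i) x = σ * pf r c x := by
      simp only [pf, Finset.mul_sum, mul_assoc]
    rw [this, hc x hx]
    rcases hσ with h | h <;> rw [h] <;> ring
  have : |σ| = 1 := by rcases hσ with h | h <;> rw [h] <;> norm_num
  rw [e, abs_mul, this, one_mul]
  exact hC x hx

/-- Remark after Theorem 3: φ_{r,n,f}(∞) < ∞ if and only if φ_{r,0,f}(∞) < ∞. -/
theorem statement7
    (f g : ℝ → ℝ)
    (hf_c : ContinuousOn f (Ici 0)) (hf_pos : ∀ t ∈ Ici (0:ℝ), 0 < f t)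
    (hf_anti : AntitoneOn f (Ici 0))
    (hg_c : ContinuousOn g (Ici 0)) (hg_pos : ∀ t ∈ Ici (0:ℝ), 0 < g t)
    (hg_anti : AntitoneOn g (Ici 0))
    (r : ℕ) (hr : 1 ≤ r) (n : ℕ) (φn φ0 : ℝ → ℝ)
    (hφn : ∀ a, 0 < a → ∃ G : ℝ → ℝ,
      IsExtremalSpline f g r n a G ∧ φn a = wNorm G f (Icc 0 a))
    (hφ0 : ∀ a, 0 < a → ∃ G : ℝ → ℝ,
      IsExtremalSpline f g r 0 a G ∧ φ0 a = wNorm G f (Icc 0 a)) :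
    (∃ C, ∀ a, 0 < a → φn a ≤ C) ↔ (∃ C, ∀ a, 0 < a → φ0 a ≤ C) := by
  obtain ⟨k, rfl⟩ : ∃ k, r = k + 1 := ⟨r - 1, by omega⟩
  let gc : ℝ → ℝ := fun x => g (max x 0)
  have hgc : Continuous gc := by
    refine hg_c.comp_continuous (continuous_id.max continuous_const) (fun x => ?_)
    exact le_max_right x (0:ℝ)
  have hgg : ∀ x, 0 ≤ x → gc x = g x := fun x hx => by simp only [gc, max_eq_left hx]
  have hPc : ∀ c a, ∀ x ∈ Ioo (0:ℝ) a,
      iteratedDeriv (k+1) (fun x => gk gc (k+1) x + pf (k+1) c x) x = g x := by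
    intro c a x hx
    rw [(P_smooth gc hgc (k+1) c).2, hgg x hx.1.le]
  have hcontG : ∀ n a G, IsExtremalSpline f g (k+1) n a G → ContinuousOn G (Icc 0 a) := by
    rintro n a G ⟨⟨m, hm, u, ε, h⟩, -⟩
    exact h.2.2.2.2.1.continuousOn
  constructor
  · rintro ⟨C, hC⟩
    obtain ⟨T, hT, hgood⟩ := good_zero f gc (k+1) C n ⟨0, le_rfl, fun a ha => by
      obtain ⟨G, hG, hφ⟩ := hφn a ha
      refine spline_good f g gc hgc hgg (k+1) n C a G hG.1 (fun t ht => ?_)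
      have h1 := wn_le f G a hf_c hf_pos (hcontG n a G hG) t ht
      have h2 := hC a ha
      have h3 := hf_pos t ht.1
      rw [hφ] at h2
      exact h1.trans (by gcongr)⟩
    obtain ⟨L, hL, hLb⟩ := pf_bound (k+1) T hT
    obtain ⟨B, hB⟩ := isCompact_Icc.exists_bound_of_continuousOn (s := Icc 0 (T+1))
      (f := gk gc (k+1)) (gk_cont gc hgc (k+1)).continuousOn
    have hfT := hf_pos (T+1) (by simp only [mem_Ici]; linarith)
    set K := B + L * (|C| * f 0 + B) with hK
    refine ⟨max C (K / f (T+1)), fun a ha => ?_⟩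
    obtain ⟨H, hH, hφ⟩ := hφ0 a ha
    rw [hφ]
    obtain ⟨G, S, h1, h2, h3⟩ := hgood (a + T + 1) (by linarith)
    obtain ⟨σ, hσ, c, hc⟩ := h2 T (a+T+1) hT (by linarith) le_rfl (fun x hx hx' => by
      have h4 : x ∈ S.filter (fun x => T < x ∧ x < a + T + 1) := Finset.mem_filter.2 ⟨hx, hx'⟩
      rw [Finset.card_eq_zero.1 (Nat.le_zero.1 h3)] at h4
      simp at h4)
    obtain ⟨d, hd⟩ := normz f gc G (k+1) C T (a+T+1) σ hσ c hc
      (fun x hx => h1 x ⟨hT.trans_lt hx.1, hx.2⟩)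
    refine comp f g hf_pos hg_pos k 0 a ha H hH _ (P_smooth gc hgc (k+1) d).1 (hPc d a) _ ?_
    intro x hx
    have hfx := hf_pos x hx.1
    rcases le_or_gt x (T+1) with hx1 | hx1
    · have b1 := hB x ⟨hx.1, hx1⟩
      rw [Real.norm_eq_abs] at b1
      have b2 := hLb d (|C| * f 0 + B) (fun y hy => by
        have e1 := hd y ⟨hy.1, by linarith [hy.2]⟩
        have hy0 : 0 ≤ y := hT.trans hy.1.le
        have e2 := hB y ⟨hy0, hy.2.le⟩
        rw [Real.norm_eq_abs] at e2
        have e3 := hf_anti (mem_Ici.2 le_rfl) (mem_Ici.2 hy0) hy0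
        have e4 : C * f y ≤ |C| * f 0 :=
          mul_le_mul (le_abs_self C) e3 (hf_pos y hy0).le (abs_nonneg C)
        have e5 : |pf (k+1) d y| ≤ |gk gc (k+1) y + pf (k+1) d y| + |gk gc (k+1) y| := by
          have := abs_sub (gk gc (k+1) y + pf (k+1) d y) (gk gc (k+1) y)
          rwa [add_sub_cancel_left] at this
        linarith) x ⟨hx.1, hx1⟩
      have b3 : |gk gc (k+1) x + pf (k+1) d x| ≤ K := (abs_add_le _ _).trans (by linarith)
      have hK0 : 0 ≤ K := (abs_nonneg _).trans b3
      calc _ ≤ K := b3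
        _ = K / f (T+1) * f (T+1) := by field_simp
        _ ≤ max C (K / f (T+1)) * f x := by
          apply mul_le_mul (le_max_right _ _) _ hfT.le
          · exact le_max_of_le_right (by positivity)
          · exact hf_anti (mem_Ici.2 hx.1) (mem_Ici.2 (by linarith)) hx1
    · refine (hd x ⟨by linarith, by linarith [hx.2]⟩).trans ?_
      gcongr
      exact le_max_left _ _
  · rintro ⟨C, hC⟩
    refine ⟨C, fun a ha => ?_⟩
    refine le_trans ?_ (hC a ha)
    obtain ⟨H, hH, hφH⟩ := hφ0 a ha
    obtain ⟨G, hG, hφG⟩ := hφn a ha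
    rw [hφG]
    have hHb := wn_le f H a hf_c hf_pos (hcontG 0 a H hH)
    rw [← hφH] at hHb
    obtain ⟨⟨m, hm, u, ε, h⟩, -⟩ := hH
    obtain rfl : m = 0 := by omega
    obtain ⟨σ, hσ, c, hc⟩ := spline_rep g gc hgc hgg (k+1) 0 a u ε H h 0 le_rfl
    rw [h.2.1, h.2.2.1] at hc
    obtain ⟨d, hd⟩ := normz f gc H (k+1) (φ0 a) 0 a σ hσ c hc
      (fun x hx => hHb x (Ioo_subset_Icc_self hx))
    have hs := P_smooth gc hgc (k+1) d
    refine comp f g hf_pos hg_pos k n a ha G hG _ hs.1 (hPc d a) _ ?_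
    intro x hx
    rw [← closure_Ioo ha.ne] at hx
    refine le_on_closure hd hs.1.continuous.abs.continuousOn ?_ hx
    rw [closure_Ioo ha.ne]
    exact continuousOn_const.mul (hf_c.mono Icc_subset_Ici_self)
end

section
/- Let g be a continuous, positive, non-increasing function on [0,∞) and let r ∈ ℕ. Assume conditions (6) hold, i.e., A_0, …, A_{r−1} are finite. Let M > 0, let 1 ≤ m ≤ r, and let h_m be an m-th antiderivative of g on [0, M] (h_m^{(m)} = g) which has m zeroes in [0, M]; denote by α_m the first zero of h_m. Then |h_m(t)| < |P_m(t)| for all t ∈ [0, α_m]. -/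
open Set Filter MeasureTheory
open scoped Topology

lemma s8_gk_cont (g : ℝ → ℝ) (hg : ContinuousOn g (Ici 0)) (k : ℕ) :
    ContinuousOn (gk g k) (Ici 0) := by
  induction k with
  | zero => exact hg
  | succ k ih =>
    intro x hx
    have hx0 : (0:ℝ) ≤ x := hx
    have h1 : ContinuousOn (fun t => ∫ s in (0:ℝ)..t, gk g k s) (uIcc 0 (x+1)) := by
      apply intervalIntegral.continuousOn_primitive_interval
      rw [uIcc_of_le (by linarith)]
      exact (ih.mono Icc_subset_Ici_self).integrableOn_Icc
    rw [uIcc_of_le (by linarith)] at h1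
    have h2 := h1 x ⟨hx0, by linarith⟩
    refine h2.mono_of_mem_nhdsWithin ?_
    rw [← Ici_inter_Iic]
    exact inter_mem_nhdsWithin _ (Iic_mem_nhds (by linarith))

lemma s8_P_cont (g : ℝ → ℝ) (hg : ContinuousOn g (Ici 0)) (k : ℕ) :
    ContinuousOn (Pfun g k) (Ici 0) := by
  unfold Pfun
  have := s8_gk_cont g hg k
  refine ContinuousOn.add ?_ (continuousOn_const.mul this)
  apply Continuous.continuousOn
  fun_prop

lemma s8_P_zero (g : ℝ → ℝ) : Pfun g 0 = g := by
  funext t; simp [Pfun, gk]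

lemma s8_A (g : ℝ → ℝ) (k : ℕ) : Acoef g k = ∫ t in Ioi (0:ℝ), Pfun g k t := by
  cases k with
  | zero => rw [s8_P_zero, Acoef]
  | succ k => rw [Acoef]; simp [Pfun]

lemma s8_ii (f : ℝ → ℝ) (hf : ContinuousOn f (Ici 0)) {a b : ℝ} (ha : 0 ≤ a) (hb : 0 ≤ b) :
    IntervalIntegrable f volume a b := by
  apply ContinuousOn.intervalIntegrable
  exact hf.mono (fun x hx => le_trans (le_min ha hb) hx.1)

lemma s8_P_succ (g : ℝ → ℝ) (hg : ContinuousOn g (Ici 0)) (k : ℕ) (t : ℝ) (ht : 0 ≤ t) :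
    Pfun g (k+1) t = Acoef g k - ∫ s in (0:ℝ)..t, Pfun g k s := by
  unfold Pfun
  rw [intervalIntegral.integral_add, intervalIntegral.integral_finsetSum,
    Fin.sum_univ_castSucc, intervalIntegral.integral_const_mul]
  · have : ∀ s : Fin k, ∫ x in (0:ℝ)..t, (-1 : ℝ) ^ (k - 1 - s.1) * Acoef g s.1 * x ^ (k - 1 - s.1) /
        (Nat.factorial (k - 1 - s.1) : ℝ) = - ((-1 : ℝ) ^ (k - s.1) * Acoef g s.1 * t ^ (k - s.1) /
        (Nat.factorial (k - s.1) : ℝ)) := by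
      intro s
      obtain ⟨j, hj⟩ : ∃ j, k - s.1 = j + 1 := ⟨k - s.1 - 1, by omega⟩
      have hj' : k - 1 - s.1 = j := by omega
      rw [hj, hj', intervalIntegral.integral_div, intervalIntegral.integral_const_mul,
        integral_pow, Nat.factorial_succ]
      have : (j.factorial : ℝ) ≠ 0 := by positivity
      have : (j : ℝ) + 1 ≠ 0 := by positivity
      push_cast
      field_simp
      ring
    rw [Finset.sum_congr rfl (fun s _ => this s)]
    simp [gk]
    ring
  · intro i _
    apply Continuous.intervalIntegrable
    fun_prop
  · apply Continuous.intervalIntegrable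
    fun_prop
  · exact s8_ii _ (continuousOn_const.mul (s8_gk_cont g hg k)) le_rfl ht

lemma s8_P_sub (g : ℝ → ℝ) (hg : ContinuousOn g (Ici 0)) (k : ℕ) (t z : ℝ) (ht : 0 ≤ t)
    (hz : 0 ≤ z) :
    Pfun g (k+1) t = Pfun g (k+1) z + ∫ s in t..z, Pfun g k s := by
  rw [s8_P_succ g hg k t ht, s8_P_succ g hg k z hz]
  have hc := s8_P_cont g hg k
  rw [← intervalIntegral.integral_interval_sub_left (s8_ii _ hc le_rfl hz) (s8_ii _ hc le_rfl ht)]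
  ring

lemma s8_P_int (g : ℝ → ℝ) (r : ℕ) (h6 : Cond6 g r) (k : ℕ) (hk : k < r) :
    IntegrableOn (Pfun g k) (Ioi 0) := by
  cases k with
  | zero => rw [s8_P_zero]; exact h6.1
  | succ k => exact h6.2 _ (by omega) (by omega)

lemma s8_P_pos (g : ℝ → ℝ) (hg : ContinuousOn g (Ici 0)) (hp : ∀ t ∈ Ici (0:ℝ), 0 < g t)
    (r : ℕ) (h6 : Cond6 g r) (k : ℕ) (hk : k ≤ r) : ∀ t, 0 ≤ t → 0 < Pfun g k t := by
  induction k with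
  | zero => intro t ht; rw [s8_P_zero]; exact hp t ht
  | succ k ih =>
    intro t ht
    have ih := ih (by omega)
    have hI := s8_P_int g r h6 k (by omega)
    have hIt : IntegrableOn (Pfun g k) (Ioi t) := hI.mono_set (Ioi_subset_Ioi ht)
    have hc := s8_P_cont g hg k
    rw [s8_P_succ g hg k t ht, s8_A,
      ← intervalIntegral.integral_Ioi_sub_Ioi hI ht, sub_sub_cancel]
    rw [setIntegral_pos_iff_support_of_nonneg_ae _ hIt]
    · have : Ioi t ⊆ Function.support (Pfun g k) ∩ Ioi t := fun x hx =>
        ⟨(ih x (ht.trans (le_of_lt hx))).ne', hx⟩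
      refine lt_of_lt_of_le ?_ (measure_mono this)
      simp
    · filter_upwards [ae_restrict_mem measurableSet_Ioi] with x hx
      exact (ih x (ht.trans (le_of_lt hx))).le

lemma s8_step (g : ℝ → ℝ) (hg : ContinuousOn g (Ici 0)) (M : ℝ) (hM : 0 < M) (k : ℕ) (h : ℝ → ℝ)
    (hs : ContDiffOn ℝ 1 h (Icc 0 M)) (z t : ℝ) (ht : 0 ≤ t) (htz : t ≤ z) (hzM : z ≤ M)
    (hz : h z = 0) (hb : ∀ s ∈ Icc t z, |derivWithin h (Icc 0 M) s| ≤ Pfun g k s) :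
    |h t| ≤ Pfun g (k+1) t - Pfun g (k+1) z := by
  rw [s8_P_sub g hg k t z ht (ht.trans htz), add_sub_cancel_left]
  have hsub : Icc t z ⊆ Icc 0 M := Icc_subset_Icc ht hzM
  have hd : ContinuousOn (derivWithin h (Icc 0 M)) (Icc 0 M) :=
    hs.continuousOn_derivWithin (uniqueDiffOn_Icc hM) le_rfl
  have hdi : IntervalIntegrable (derivWithin h (Icc 0 M)) volume t z := by
    apply ContinuousOn.intervalIntegrable
    rw [uIcc_of_le htz]; exact hd.mono hsub
  have hF : ∫ s in t..z, derivWithin h (Icc 0 M) s = h z - h t := by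
    apply intervalIntegral.integral_eq_sub_of_hasDerivAt_of_le htz (hs.continuousOn.mono hsub) _ hdi
    intro x hx
    have hx' : x ∈ Icc 0 M := hsub (Ioo_subset_Icc_self hx)
    exact ((hs.differentiableOn one_ne_zero x hx').hasDerivWithinAt).hasDerivAt
      (Icc_mem_nhds (lt_of_le_of_lt ht hx.1) (lt_of_lt_of_le hx.2 hzM))
  have : |h t| = |∫ s in t..z, derivWithin h (Icc 0 M) s| := by rw [hF, hz]; simp
  rw [this]
  refine (intervalIntegral.abs_integral_le_integral_abs htz).trans ?_
  exact intervalIntegral.integral_mono_on htz hdi.abs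
    (s8_ii _ (s8_P_cont g hg k) ht (ht.trans htz)) hb

lemma s8_main (g : ℝ → ℝ) (hg : ContinuousOn g (Ici 0)) (hp : ∀ t ∈ Ici (0:ℝ), 0 < g t)
    (r : ℕ) (h6 : Cond6 g r) (M : ℝ) (hM : 0 < M) (m : ℕ) (hm : m ≤ r) :
    ∀ (h : ℝ → ℝ), ContDiffOn ℝ (m : ℕ) h (Icc 0 M) →
    (∀ t ∈ Icc (0:ℝ) M, iteratedDerivWithin m h (Icc 0 M) t = g t) →
    ∀ z : Fin m → ℝ, StrictMono z → (∀ i, z i ∈ Icc (0:ℝ) M ∧ h (z i) = 0) →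
    ∀ t ∈ Icc (0:ℝ) M, (∀ i, t ≤ z i) → |h t| ≤ Pfun g m t ∧ (1 ≤ m → |h t| < Pfun g m t) := by
  induction m with
  | zero =>
    intro h _ hd z _ _ t ht _
    have := hd t ht
    rw [iteratedDerivWithin_zero] at this
    rw [this, s8_P_zero, abs_of_pos (hp t ht.1)]
    exact ⟨le_rfl, by omega⟩
  | succ k ih =>
    intro h hs hd z hz hz0 t ht htz
    have hs1 : ContDiffOn ℝ 1 h (Icc 0 M) := hs.of_le (by norm_cast; omega)
    have hs' : ContDiffOn ℝ k (derivWithin h (Icc 0 M)) (Icc 0 M) :=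
      hs.derivWithin (uniqueDiffOn_Icc hM) (by norm_cast)
    have hd' : ∀ t ∈ Icc (0:ℝ) M,
        iteratedDerivWithin k (derivWithin h (Icc 0 M)) (Icc 0 M) t = g t := by
      intro t ht
      rw [← hd t ht, iteratedDerivWithin_succ']
    have hR : ∀ i : Fin k, ∃ w ∈ Ioo (z i.castSucc) (z i.succ), derivWithin h (Icc 0 M) w = 0 := by
      intro i
      have hsub : Icc (z i.castSucc) (z i.succ) ⊆ Icc 0 M :=
        Icc_subset_Icc (hz0 _).1.1 (hz0 _).1.2
      obtain ⟨w, hw, hw0⟩ := exists_deriv_eq_zero (f := h) (hz (Fin.castSucc_lt_succ (i := i)))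
        (hs.continuousOn.mono hsub) (by rw [(hz0 _).2, (hz0 _).2])
      refine ⟨w, hw, ?_⟩
      rw [derivWithin_of_mem_nhds, hw0]
      exact Icc_mem_nhds (lt_of_le_of_lt (hz0 _).1.1 hw.1) (lt_of_lt_of_le hw.2 (hz0 _).1.2)
    choose w hw hw0 using hR
    have hwm : StrictMono w := by
      intro i j hij
      refine (hw i).2.trans_le (le_trans (hz.monotone ?_) (hw j).1.le)
      rw [Fin.le_def]; simp; exact hij
    have key := ih (by omega) (derivWithin h (Icc 0 M)) hs' hd' w hwm
      (fun i => ⟨⟨(hz0 _).1.1.trans (hw i).1.le, (hw i).2.le.trans (hz0 _).1.2⟩, hw0 i⟩)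
    have hb := s8_step g hg M hM k h hs1 (z 0) t ht.1 (htz 0) (hz0 0).1.2 (hz0 0).2
      (fun s hs => (key s ⟨ht.1.trans hs.1, hs.2.trans (hz0 0).1.2⟩ (fun i =>
        hs.2.trans ((hz.monotone (Fin.zero_le _)).trans (hw i).1.le))).1)
    have hpos := s8_P_pos g hg hp r h6 (k+1) hm (z 0) (hz0 0).1.1
    have : |h t| < Pfun g (k+1) t := by linarith
    exact ⟨this.le, fun _ => this⟩

/-- Lemma 3 (first inequality): if h_m is an m-th antiderivative of g on [0,M]
with m zeroes and α_m is its first zero, then |h_m(t)| < |P_m(t)| on [0, α_m]. -/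
theorem statement8
    (g : ℝ → ℝ)
    (hg_c : ContinuousOn g (Ici 0)) (hg_pos : ∀ t ∈ Ici (0:ℝ), 0 < g t)
    (hg_anti : AntitoneOn g (Ici 0))
    (r : ℕ) (hr : 1 ≤ r) (h6 : Cond6 g r)
    (M : ℝ) (hM : 0 < M) (m : ℕ) (hm1 : 1 ≤ m) (hm2 : m ≤ r)
    (h : ℝ → ℝ) (h_smooth : ContDiffOn ℝ (m : ℕ) h (Icc 0 M))
    (h_deriv : ∀ t ∈ Icc (0:ℝ) M, iteratedDerivWithin m h (Icc 0 M) t = g t)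
    (h_zeroes : ∃ z : Fin m → ℝ, StrictMono z ∧ ∀ i, z i ∈ Icc (0:ℝ) M ∧ h (z i) = 0)
    (α : ℝ) (hα : IsLeast {t ∈ Icc (0:ℝ) M | h t = 0} α) :
    ∀ t ∈ Icc (0:ℝ) α, |h t| < |Pfun g m t| := by
  intro t ht
  obtain ⟨z, hz, hz0⟩ := h_zeroes
  have hαz : ∀ i, α ≤ z i := fun i => hα.2 ⟨(hz0 i).1, (hz0 i).2⟩
  have := (s8_main g hg_c hg_pos r h6 M hM m hm2 h h_smooth h_deriv z hz hz0 t
    ⟨ht.1, ht.2.trans hα.1.1.2⟩ (fun i => ht.2.trans (hαz i))).2 hm1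
  exact this.trans_le (le_abs_self _)
end
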